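/- There exists a constant C > 0, depending only on N, p, η and ξ (and the constant C₀ in the decay bound for w), such that the following holds. Let ℓ ≥ 2, let Π ⊂ ℝᴺ be a finite nonempty set whose distinct points are at mutual distance at least ℓ, let ε : Π → {−1, +1}, and set U = Σ_{y∈Π} ε(y) w(·−y) and E = ΔU − U + |U|^{p−1}U. Suppose φ : ℝᴺ → ℝ is twice continuously differentiable, u := U + φ satisfies Δu − u + |u|^{p−1}u = 0 on ℝᴺ, and ‖φ‖_* ≤ e^{−(1+ξ)ℓ/2} and ‖E‖_* ≤ e^{−(1+ξ)ℓ/2}. Then for every α ∈ {1,…,N}, ‖∂φ/∂x_α‖_* ≤ C e^{−(1+ξ)ℓ/2}. -/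

import Mathlib

open MeasureTheory

/-- The partial derivative `∂f/∂x_α` of `f : ℝᴺ → ℝ`. -/
noncomputable def pdc {N : ℕ} (α : Fin N) (f : EuclideanSpace ℝ (Fin N) → ℝ)
    (x : EuclideanSpace ℝ (Fin N)) : ℝ :=
  fderiv ℝ f x (EuclideanSpace.single α 1)

/-- The Laplacian `Δf = Σ_α ∂²f/∂x_α²` of `f : ℝᴺ → ℝ`. -/
noncomputable def lapl {N : ℕ} (f : EuclideanSpace ℝ (Fin N) → ℝ)
    (x : EuclideanSpace ℝ (Fin N)) : ℝ :=
  ∑ α : Fin N, pdc α (pdc α f) x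

/-! ### An interior gradient estimate for the Laplacian -/

lemma nonneg_of_isLocalMin_of_hasDerivAt {h h' : ℝ → ℝ} {a c : ℝ} (hmin : IsLocalMin h a)
    (hd : ∀ t, HasDerivAt h (h' t) t) (hd' : HasDerivAt h' c a) : 0 ≤ c := by
  by_contra! hc
  have hderiv : deriv h = h' := funext fun t => (hd t).deriv
  have h0 : h' a = 0 := hmin.hasDerivAt_eq_zero (hd a)
  have hmax : IsLocalMax h a :=
    isLocalMax_of_deriv_deriv_neg (by rw [hderiv, hd'.deriv]; exact hc)
      (by rw [hderiv, h0]) (hd a).continuousAt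
  have hconst : h =ᶠ[nhds a] fun _ => h a := by
    filter_upwards [hmin, hmax] with t h1 h2 using le_antisymm h2 h1
  have h1 : h' =ᶠ[nhds a] fun _ => 0 := by
    have := hconst.deriv
    rw [hderiv] at this
    exact this.trans (by simp)
  have h2 : HasDerivAt h' 0 a := (hasDerivAt_const a (0 : ℝ)).congr_of_eventuallyEq h1
  exact hc.ne (hd'.unique h2)

lemma nonpos_of_hasDerivAt_of_nonpos_right {q : ℝ → ℝ} {c : ℝ} (hd : HasDerivAt q c 0)
    (h0 : q 0 = 0) (hq : ∀ t, 0 < t → t < 1 → q t ≤ 0) : c ≤ 0 := by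
  have h1 := hd.hasDerivWithinAt (s := Set.Ioi 0)
  rw [hasDerivWithinAt_iff_tendsto_slope' (by simp)] at h1
  refine le_of_tendsto h1 ?_
  filter_upwards [Ioo_mem_nhdsGT (zero_lt_one' ℝ)] with t ht
  rw [slope_def_field, h0]
  exact div_nonpos_of_nonpos_of_nonneg (by simpa using hq t ht.1 ht.2) (by linarith [ht.1])

section

variable {N : ℕ}

local notation "𝔼" => EuclideanSpace ℝ (Fin N)

lemma hasDerivAt_comp_line {f : 𝔼 → ℝ} (hf : Differentiable ℝ f) (β : Fin N) (a : 𝔼) (c t : ℝ) :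
    HasDerivAt (fun t : ℝ => f (a + (c * t) • EuclideanSpace.single β (1 : ℝ)))
      (c * pdc β f (a + (c * t) • EuclideanSpace.single β (1 : ℝ))) t := by
  have h1 : HasDerivAt (fun t : ℝ => a + (c * t) • EuclideanSpace.single β (1 : ℝ))
      ((c * 1) • EuclideanSpace.single β (1 : ℝ)) t :=
    (((hasDerivAt_id t).const_mul c).smul_const _).const_add a
  have h2 := (hf _).hasFDerivAt.comp_hasDerivAt t h1
  simpa [pdc, Function.comp_def] using h2

lemma ContDiff.pdc {f : 𝔼 → ℝ} {n m : WithTop ℕ∞} (hf : ContDiff ℝ n f) (hmn : m + 1 ≤ n)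
    (β : Fin N) : ContDiff ℝ m (pdc β f) :=
  (hf.fderiv_right hmn).clm_apply contDiff_const

/-- The reflection in the hyperplane orthogonal to the `α`-th coordinate axis. -/
noncomputable def coordReflection (α : Fin N) (z : 𝔼) : 𝔼 :=
  z - (2 * z α) • EuclideanSpace.single α (1 : ℝ)

lemma norm_coordReflection (α : Fin N) (z : 𝔼) : ‖coordReflection α z‖ = ‖z‖ := by
  have : ‖coordReflection α z‖ ^ 2 = ‖z‖ ^ 2 := by
    rw [coordReflection, norm_sub_sq_real, inner_smul_right, norm_smul]
    simp [EuclideanSpace.inner_single_right, mul_pow]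
    ring
  exact (pow_left_inj₀ (norm_nonneg _) (norm_nonneg _) two_ne_zero).1 this

lemma coordReflection_add_smul (α β : Fin N) (z : 𝔼) (t : ℝ) :
    coordReflection α (z + t • EuclideanSpace.single β (1 : ℝ)) = coordReflection α z
      + ((if β = α then -1 else 1) * t) • EuclideanSpace.single β (1 : ℝ) := by
  ext i
  by_cases hβ : β = α
  · subst hβ
    simp [coordReflection]
    by_cases hi : i = β <;> simp [hi]; ring
  · simp [coordReflection, hβ, Ne.symm hβ]
    ring

lemma norm_add_smul_single_sq (z : 𝔼) (β : Fin N) (t : ℝ) :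
    ‖z + t • EuclideanSpace.single β (1 : ℝ)‖ ^ 2 = ‖z‖ ^ 2 + 2 * t * z β + t ^ 2 := by
  rw [norm_add_sq_real, inner_smul_right, norm_smul]
  simp [EuclideanSpace.inner_single_right]
  ring

/-- The comparison function for the gradient estimate on a half ball. -/
noncomputable def barrier (M K : ℝ) (α : Fin N) (z : 𝔼) : ℝ :=
  M * (‖z‖ ^ 2 + N * (z α - z α ^ 2)) + K / 2 * (z α - z α ^ 2)

lemma barrier_add_smul (M K : ℝ) (α β : Fin N) (z : 𝔼) (t : ℝ) :
    barrier M K α (z + t • EuclideanSpace.single β (1 : ℝ)) = barrier M K α z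
      + (2 * M * z β + (M * N + K / 2) * (if β = α then 1 - 2 * z α else 0)) * t
      + (M - (M * N + K / 2) * (if β = α then 1 else 0)) * t ^ 2 := by
  rw [barrier, barrier, norm_add_smul_single_sq]
  by_cases hβ : β = α
  · subst hβ
    simp
    ring
  · simp [hβ, Ne.symm hβ]
    ring

lemma half_reflection_le_barrier {φ : 𝔼 → ℝ} (hφ : ContDiff ℝ 2 φ) (x₀ : 𝔼) (α : Fin N)
    {M K : ℝ} (hM : ∀ z, ‖z‖ ≤ 1 → |φ (x₀ + z)| ≤ M)
    (hK : ∀ z, ‖z‖ ≤ 1 → |lapl φ (x₀ + z)| < K) {z : 𝔼} (hz : ‖z‖ ≤ 1) (hzα : 0 ≤ z α) :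
    1 / 2 * (φ (x₀ + z) - φ (x₀ + coordReflection α z)) ≤ barrier M K α z := by
  set h : 𝔼 → ℝ := fun z => barrier M K α z
    - 1 / 2 * (φ (x₀ + z) - φ (x₀ + coordReflection α z)) with hh
  suffices 0 ≤ h z by simpa [hh] using this
  have hM0 : 0 ≤ M := (abs_nonneg _).trans (hM 0 (by simp))
  have hK0 : 0 ≤ K := (abs_nonneg _).trans (hK 0 (by simp)).le
  have hcoord : Continuous fun z : 𝔼 => z α := by fun_prop
  have hcont : Continuous h := by
    have := hφ.continuous
    simp only [hh, barrier, coordReflection]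
    fun_prop
  have hS : IsCompact (Metric.closedBall (0 : 𝔼) 1 ∩ {z | 0 ≤ z α}) :=
    (isCompact_closedBall _ _).inter_right (isClosed_le continuous_const hcoord)
  obtain ⟨y, ⟨hy1, hy2⟩, hymin⟩ := hS.exists_isMinOn ⟨z, by simpa using ⟨hz, hzα⟩⟩
    hcont.continuousOn
  refine le_trans ?_ (hymin (show z ∈ _ by simpa using ⟨hz, hzα⟩))
  simp only [mem_closedBall_zero_iff, Set.mem_ofPred_eq] at hy1 hy2
  have hyα : y α ≤ 1 := (le_abs_self _).trans ((PiLp.norm_apply_le y α).trans hy1)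
  have hsq : 0 ≤ y α - y α ^ 2 := by nlinarith
  by_contra! hneg
  have hy1' : ‖y‖ < 1 := by
    refine lt_of_le_of_ne hy1 fun h1 => hneg.not_ge ?_
    have e1 := abs_le.1 (hM y hy1)
    have e2 := abs_le.1 (hM (coordReflection α y) (by rwa [norm_coordReflection]))
    have : M ≤ barrier M K α y := by
      rw [barrier, h1]
      have : 0 ≤ (N : ℝ) * (y α - y α ^ 2) := by positivity
      have := mul_nonneg hM0 this
      have : 0 ≤ K / 2 * (y α - y α ^ 2) := by positivity
      linarith
    simp only [hh]
    linarith
  have hy2' : 0 < y α := by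
    refine lt_of_le_of_ne hy2 fun h1 => hneg.not_ge ?_
    simp only [hh, barrier, coordReflection, ← h1]
    simp only [mul_zero, zero_smul, sub_zero, sub_self, zero_pow two_ne_zero, add_zero]
    positivity
  have hloc : IsLocalMin h y := by
    refine hymin.isLocalMin ?_
    filter_upwards [Metric.isOpen_ball.mem_nhds (mem_ball_zero_iff.2 hy1'),
      (isOpen_lt continuous_const hcoord).mem_nhds hy2'] with x hx1 hx2
    exact ⟨Metric.ball_subset_closedBall hx1, le_of_lt hx2⟩
  have hφd : Differentiable ℝ φ := hφ.differentiable two_ne_zero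
  have hφd' : ∀ β, Differentiable ℝ (pdc β φ) := fun β =>
    (hφ.pdc (m := 1) (by norm_num) β).differentiable one_ne_zero
  have key : ∀ β : Fin N, 0 ≤ 2 * (M - (M * N + K / 2) * (if β = α then 1 else 0))
      - 1 / 2 * (pdc β (pdc β φ) (x₀ + y) - pdc β (pdc β φ) (x₀ + coordReflection α y)) := by
    intro β
    set s : ℝ := if β = α then -1 else 1 with hs
    have hss : s * s = 1 := by rw [hs]; split_ifs <;> norm_num
    set e : 𝔼 := EuclideanSpace.single β (1 : ℝ) with he
    set b : ℝ := 2 * M * y β + (M * N + K / 2) * (if β = α then 1 - 2 * y α else 0)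
    set c : ℝ := M - (M * N + K / 2) * (if β = α then 1 else 0)
    have hline : (fun t : ℝ => h (y + t • e)) = fun t => (barrier M K α y + b * t + c * t ^ 2)
        - 1 / 2 * (φ (x₀ + y + (1 * t) • e) - φ (x₀ + coordReflection α y + (s * t) • e)) := by
      funext t
      simp only [hh, he, barrier_add_smul, coordReflection_add_smul, add_assoc, one_mul]
      rfl
    have hlocline : IsLocalMin (fun t : ℝ => h (y + t • e)) 0 := by
      have hc : ContinuousAt (fun t : ℝ => y + t • e) 0 := by fun_prop
      have hl : IsLocalMin h (y + (0 : ℝ) • e) := by simpa using hloc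
      exact IsMinFilter.comp_tendsto (g := fun t : ℝ => y + t • e) hl hc.tendsto
    rw [hline] at hlocline
    have hd : ∀ t, HasDerivAt (fun t => (barrier M K α y + b * t + c * t ^ 2)
        - 1 / 2 * (φ (x₀ + y + (1 * t) • e) - φ (x₀ + coordReflection α y + (s * t) • e)))
        ((b + 2 * c * t) - 1 / 2 * (1 * pdc β φ (x₀ + y + (1 * t) • e)
          - s * pdc β φ (x₀ + coordReflection α y + (s * t) • e))) t := by
      intro t
      have h1 : HasDerivAt (fun t => barrier M K α y + b * t + c * t ^ 2) (b + 2 * c * t) t := by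
        have := (((hasDerivAt_id t).const_mul b).const_add (barrier M K α y)).add
          ((hasDerivAt_pow 2 t).const_mul c)
        refine this.congr_deriv ?_
        simp; ring
      exact h1.sub (((hasDerivAt_comp_line hφd β _ 1 t).sub
        (hasDerivAt_comp_line hφd β _ s t)).const_mul _)
    have hd' : HasDerivAt (fun t => (b + 2 * c * t) - 1 / 2 * (1 * pdc β φ (x₀ + y + (1 * t) • e)
          - s * pdc β φ (x₀ + coordReflection α y + (s * t) • e)))
        (2 * c - 1 / 2 * (pdc β (pdc β φ) (x₀ + y)
          - pdc β (pdc β φ) (x₀ + coordReflection α y))) 0 := by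
      have h1 : HasDerivAt (fun t => b + 2 * c * t) (2 * c * 1) 0 :=
        ((hasDerivAt_id _).const_mul (2 * c)).const_add b
      refine (h1.sub ((((hasDerivAt_comp_line (hφd' β) β (x₀ + y) 1 0).const_mul 1).sub
        ((hasDerivAt_comp_line (hφd' β) β (x₀ + coordReflection α y) s 0).const_mul
          s)).const_mul (1 / 2))).congr_deriv ?_
      rw [← mul_assoc s s, hss]
      simp
    exact nonneg_of_isLocalMin_of_hasDerivAt hlocline hd hd'
  have hsum := Finset.sum_nonneg fun β (_ : β ∈ Finset.univ) => key β
  rw [Finset.sum_sub_distrib, ← Finset.mul_sum, ← Finset.mul_sum, Finset.sum_sub_distrib,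
    Finset.sum_sub_distrib, ← Finset.mul_sum] at hsum
  simp only [Finset.sum_ite_eq', Finset.mem_univ, if_true, Finset.sum_const, Finset.card_univ,
    Fintype.card_fin, nsmul_eq_mul] at hsum
  have e1 := abs_lt.1 (hK y hy1)
  have e2 := abs_lt.1 (hK (coordReflection α y) (by rwa [norm_coordReflection]))
  simp only [lapl] at e1 e2
  linarith

lemma pdc_le_of_lapl_lt {φ : 𝔼 → ℝ} (hφ : ContDiff ℝ 2 φ) (x₀ : 𝔼) (α : Fin N)
    {M K : ℝ} (hM : ∀ z, ‖z‖ ≤ 1 → |φ (x₀ + z)| ≤ M)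
    (hK : ∀ z, ‖z‖ ≤ 1 → |lapl φ (x₀ + z)| < K) : pdc α φ x₀ ≤ N * M + K / 2 := by
  have hφd : Differentiable ℝ φ := hφ.differentiable two_ne_zero
  set e : 𝔼 := EuclideanSpace.single α (1 : ℝ) with he
  have hbar : ∀ t : ℝ, barrier M K α (t • e)
      = (M * N + K / 2) * t + (M - (M * N + K / 2)) * t ^ 2 := fun t => by
    have := barrier_add_smul M K α α 0 t
    simpa [barrier, he] using this
  have hrefl : ∀ t : ℝ, coordReflection α (t • e) = (-1 * t) • e := fun t => by
    have := coordReflection_add_smul α α 0 t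
    simpa [coordReflection, he] using this
  have hd : HasDerivAt (fun t : ℝ => 1 / 2 * (φ (x₀ + (1 * t) • e) - φ (x₀ + (-1 * t) • e))
      - ((M * N + K / 2) * t + (M - (M * N + K / 2)) * t ^ 2))
      (pdc α φ x₀ - (M * N + K / 2)) 0 := by
    have h1 : HasDerivAt (fun t => (M * N + K / 2) * t + (M - (M * N + K / 2)) * t ^ 2)
        (M * N + K / 2) (0 : ℝ) := by
      have := ((hasDerivAt_id (0 : ℝ)).const_mul (M * N + K / 2)).add
          ((hasDerivAt_pow 2 0).const_mul (M - (M * N + K / 2)))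
      refine this.congr_deriv ?_
      simp
    refine ((((hasDerivAt_comp_line hφd α x₀ 1 0).sub
        (hasDerivAt_comp_line hφd α x₀ (-1) 0)).const_mul (1 / 2)).sub h1).congr_deriv ?_
    simp
    ring
  have := nonpos_of_hasDerivAt_of_nonpos_right hd (by simp) fun t ht0 ht1 => by
    have := half_reflection_le_barrier hφ x₀ α hM hK (z := t • e)
      (by rw [norm_smul]; simp [he, abs_of_pos ht0, ht1.le]) (by simp [he, ht0.le])
    rw [hbar, hrefl] at this
    rw [one_mul]
    linarith
  linarith

lemma abs_pdc_le_of_lapl_lt {φ : 𝔼 → ℝ} (hφ : ContDiff ℝ 2 φ) (x₀ : 𝔼) (α : Fin N)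
    {M K : ℝ} (hM : ∀ z, ‖z‖ ≤ 1 → |φ (x₀ + z)| ≤ M)
    (hK : ∀ z, ‖z‖ ≤ 1 → |lapl φ (x₀ + z)| < K) : |pdc α φ x₀| ≤ N * M + K / 2 := by
  have hneg : ∀ (β : Fin N) (f : 𝔼 → ℝ), pdc β (fun z => -f z) = fun z => -pdc β f z :=
    fun β f => by
      funext x
      simp [pdc, fderiv_fun_neg]
  refine abs_le'.2 ⟨pdc_le_of_lapl_lt hφ x₀ α hM hK, ?_⟩
  have := pdc_le_of_lapl_lt (φ := fun z => -φ z) hφ.neg x₀ α (M := M) (K := K)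
    (by simpa using hM) (by simpa [lapl, hneg] using hK)
  simpa [hneg] using this

end

/-! ### Exponential sums over separated sets and the power nonlinearity -/

lemma integrable_exp_neg_mul_norm {E : Type*} [NormedAddCommGroup E] [NormedSpace ℝ E]
    [FiniteDimensional ℝ E] [MeasurableSpace E] [BorelSpace E] (μ : Measure E)
    [μ.IsAddHaarMeasure] {a : ℝ} (ha : 0 < a) :
    Integrable (fun x : E => Real.exp (-a * ‖x‖)) μ := by
  set n : ℕ := Module.finrank ℝ E + 1 with hn
  have hint : Integrable (fun x : E => (1 + ‖x‖) ^ (-(n : ℝ))) μ :=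
    integrable_one_add_norm (by rw [hn]; push_cast; linarith)
  refine (hint.const_mul (Real.exp a * (n.factorial / a ^ n))).mono'
    (by fun_prop) (Filter.Eventually.of_forall fun x => ?_)
  have hx : (0 : ℝ) < 1 + ‖x‖ := by positivity
  rw [Real.norm_eq_abs, abs_of_pos (Real.exp_pos _), Real.rpow_neg hx.le, Real.rpow_natCast]
  have h1 := Real.pow_div_factorial_le_exp (a * (1 + ‖x‖)) (by positivity) n
  have h2 : Real.exp (-a * ‖x‖) = Real.exp a / Real.exp (a * (1 + ‖x‖)) := by
    rw [← Real.exp_sub]; ring_nf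
  rw [h2, mul_assoc, div_eq_mul_inv]
  refine mul_le_mul_of_nonneg_left ?_ (Real.exp_pos a).le
  refine (inv_anti₀ (by positivity) h1).trans_eq ?_
  rw [mul_pow]
  field_simp

lemma exists_sum_exp_le (E : Type*) [NormedAddCommGroup E] [NormedSpace ℝ E]
    [FiniteDimensional ℝ E] [MeasurableSpace E] [BorelSpace E] {η : ℝ} (hη : η < 0) :
    ∃ B : ℝ, 0 ≤ B ∧ ∀ s : Finset E, (∀ y ∈ s, ∀ z ∈ s, y ≠ z → 2 ≤ ‖y - z‖) →
      ∀ x, ∑ y ∈ s, Real.exp (η * ‖x - y‖) ≤ B := by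
  set μ : Measure E := Measure.addHaar
  have hint := integrable_exp_neg_mul_norm μ (neg_pos.2 hη)
  simp only [neg_neg] at hint
  set V : ℝ := μ.real (Metric.ball (0 : E) 1)
  have hV : 0 < V := by
    refine ENNReal.toReal_pos (Metric.isOpen_ball.measure_pos μ ?_).ne' measure_ball_lt_top.ne
    exact ⟨0, by simp⟩
  refine ⟨Real.exp (-η) * (∫ z, Real.exp (η * ‖z‖) ∂μ) / V, by positivity, fun s hs x => ?_⟩
  rw [le_div_iff₀ hV]
  have hintx : Integrable (fun z => Real.exp (η * ‖x - z‖)) μ := hint.comp_sub_left x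
  have hball : ∀ y : E, Real.exp (η * ‖x - y‖) * V
      ≤ Real.exp (-η) * ∫ z in Metric.ball y 1, Real.exp (η * ‖x - z‖) ∂μ := by
    intro y
    have hVy : μ.real (Metric.ball y 1) = V := by
      simp only [V, Measure.real, Measure.addHaar_ball_center]
    rw [← hVy, mul_comm, ← smul_eq_mul, ← setIntegral_const, ← integral_const_mul]
    refine setIntegral_mono_on ?_ (hintx.const_mul _).integrableOn measurableSet_ball ?_
    · exact integrableOn_const measure_ball_lt_top.ne
    · intro z hz
      rw [← Real.exp_add, Real.exp_le_exp]
      have hz' : ‖z - y‖ < 1 := by simpa [dist_eq_norm] using hz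
      have : ‖x - z‖ ≤ ‖x - y‖ + ‖z - y‖ := by
        rw [← norm_neg (z - y)]
        exact (norm_add_le _ _).trans_eq' (by congr 1; abel)
      nlinarith
  calc (∑ y ∈ s, Real.exp (η * ‖x - y‖)) * V
      ≤ ∑ y ∈ s, Real.exp (-η) * ∫ z in Metric.ball y 1, Real.exp (η * ‖x - z‖) ∂μ := by
        rw [Finset.sum_mul]
        exact Finset.sum_le_sum fun y _ => hball y
    _ = Real.exp (-η) * ∫ z in ⋃ y ∈ s, Metric.ball y 1, Real.exp (η * ‖x - z‖) ∂μ := by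
        rw [← Finset.mul_sum, integral_biUnion_finset s (fun _ _ => measurableSet_ball) ?_
          fun _ _ => hintx.integrableOn]
        intro y hy z hz hyz
        refine Metric.ball_disjoint_ball ?_
        rw [dist_eq_norm]
        linarith [hs y hy z hz hyz]
    _ ≤ Real.exp (-η) * ∫ z, Real.exp (η * ‖x - z‖) ∂μ := by
        refine mul_le_mul_of_nonneg_left ?_ (Real.exp_pos _).le
        exact setIntegral_le_integral hintx
          (Filter.Eventually.of_forall fun z => (Real.exp_pos _).le)
    _ = Real.exp (-η) * ∫ z, Real.exp (η * ‖z‖) ∂μ := by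
        rw [integral_sub_left_eq_self (fun z => Real.exp (η * ‖z‖)) μ x]

lemma abs_rpow_sub_rpow_le {p R a b : ℝ} (hp : 1 < p) (ha : 0 ≤ a) (haR : a ≤ R) (hb : 0 ≤ b)
    (hbR : b ≤ R) : |a ^ p - b ^ p| ≤ p * R ^ (p - 1) * |a - b| := by
  have hd : ∀ x : ℝ, HasDerivAt (fun x : ℝ => x ^ p) (p * x ^ (p - 1)) x := fun x =>
    Real.hasDerivAt_rpow_const (Or.inr hp.le)
  refine (convex_Icc 0 R).norm_image_sub_le_of_norm_deriv_le (f := fun x : ℝ => x ^ p)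
    (fun x _ => (hd x).differentiableAt) (fun x hx => ?_) ⟨hb, hbR⟩ ⟨ha, haR⟩
  rw [(hd x).deriv, Real.norm_eq_abs, abs_of_nonneg
    (mul_nonneg (by linarith) (Real.rpow_nonneg hx.1 _))]
  exact mul_le_mul_of_nonneg_left (Real.rpow_le_rpow hx.1 hx.2 (by linarith)) (by linarith)

lemma abs_rpow_mul_self_eq {p : ℝ} (hp : 1 < p) (a : ℝ) :
    |a| ^ (p - 1) * a = (max a 0) ^ p - (max (-a) 0) ^ p := by
  have hp0 : p ≠ 0 := by linarith
  have hpos : ∀ a : ℝ, 0 ≤ a → a ^ (p - 1) * a = a ^ p := fun a ha => by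
    rcases ha.eq_or_lt with rfl | ha
    · simp [Real.zero_rpow hp0]
    · rw [← Real.rpow_add_one ha.ne', sub_add_cancel]
  rcases le_total 0 a with ha | ha
  · rw [abs_of_nonneg ha, max_eq_left ha, max_eq_right (by linarith), Real.zero_rpow hp0, hpos a ha,
      sub_zero]
  · rw [abs_of_nonpos ha, max_eq_right ha, max_eq_left (by linarith), Real.zero_rpow hp0,
      ← hpos (-a) (by linarith)]
    ring

lemma abs_rpow_mul_self_sub_le {p R a b : ℝ} (hp : 1 < p) (ha : |a| ≤ R) (hb : |b| ≤ R) :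
    |(|a| ^ (p - 1) * a) - |b| ^ (p - 1) * b| ≤ 2 * (p * R ^ (p - 1)) * |a - b| := by
  obtain ⟨ha1, ha2⟩ := abs_le.1 ha
  obtain ⟨hb1, hb2⟩ := abs_le.1 hb
  have hR : 0 ≤ R := (abs_nonneg a).trans ha
  have hL : 0 ≤ p * R ^ (p - 1) := mul_nonneg (by linarith) (Real.rpow_nonneg hR _)
  rw [abs_rpow_mul_self_eq hp, abs_rpow_mul_self_eq hp]
  have h1 := abs_rpow_sub_rpow_le hp (le_max_right a 0) (max_le ha2 hR) (le_max_right b 0)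
    (max_le hb2 hR)
  have h2 := abs_rpow_sub_rpow_le hp (le_max_right (-a) 0) (max_le (by linarith) hR)
    (le_max_right (-b) 0) (max_le (by linarith) hR)
  have h3 := mul_le_mul_of_nonneg_left (abs_max_sub_max_le_abs a b 0) hL
  have h4 := mul_le_mul_of_nonneg_left (abs_max_sub_max_le_abs (-a) (-b) 0) hL
  rw [show -a - -b = -(a - b) by ring, abs_neg] at h4
  calc _ = |((max a 0) ^ p - (max b 0) ^ p) - ((max (-a) 0) ^ p - (max (-b) 0) ^ p)| := by
        congr 1; ring
    _ ≤ _ := (abs_sub _ _).trans (by linarith)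

/-! ### Functions that are Lipschitz near a point -/

/-- `f` is Lipschitz on some neighborhood of `x`. -/
def LipschitzNear {X : Type*} [NormedAddCommGroup X] (f : X → ℝ) (x : X) : Prop :=
  (fun q : X × X => f q.1 - f q.2) =O[nhds (x, x)] fun q => q.1 - q.2

namespace LipschitzNear

variable {X Y : Type*} [NormedAddCommGroup X] [NormedAddCommGroup Y] {f g : X → ℝ} {x : X}

lemma continuousAt (hf : LipschitzNear f x) : ContinuousAt f x := by
  have h1 : Filter.Tendsto (fun z => (z, x)) (nhds x) (nhds (x, x)) :=
    Continuous.tendsto' (by fun_prop) _ _ rfl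
  have h2 : Filter.Tendsto (fun q : X × X => q.1 - q.2) (nhds (x, x)) (nhds 0) :=
    Continuous.tendsto' (by fun_prop) _ _ (by simp)
  have h3 := (hf.trans_tendsto h2).comp h1
  rw [ContinuousAt, tendsto_iff_norm_sub_tendsto_zero]
  simpa [Function.comp_def] using h3.norm

lemma congr (hf : LipschitzNear f x) (h : f =ᶠ[nhds x] g) : LipschitzNear g x := by
  refine Asymptotics.IsBigO.congr' hf ?_ Filter.EventuallyEq.rfl
  rw [nhds_prod_eq]
  filter_upwards [h.prod_mk h] with q hq using by rw [hq.1, hq.2]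

lemma add (hf : LipschitzNear f x) (hg : LipschitzNear g x) :
    LipschitzNear (fun z => f z + g z) x :=
  (Asymptotics.IsBigO.add hf hg).congr_left fun q => by ring

lemma sum {ι : Type*} {s : Finset ι} {f : ι → X → ℝ} (h : ∀ i ∈ s, LipschitzNear (f i) x) :
    LipschitzNear (fun z => ∑ i ∈ s, f i z) x :=
  (Asymptotics.IsBigO.sum h).congr_left fun q => by simp [Finset.sum_apply]

lemma mul (hf : LipschitzNear f x) (hg : LipschitzNear g x) :
    LipschitzNear (fun z => f z * g z) x := by
  have h1 : (fun q : X × X => f q.1) =O[nhds (x, x)] fun _ => (1 : ℝ) :=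
    Filter.Tendsto.isBigO_one ℝ (hf.continuousAt.tendsto.comp continuous_fst.continuousAt)
  have h2 : (fun q : X × X => g q.2) =O[nhds (x, x)] fun _ => (1 : ℝ) :=
    Filter.Tendsto.isBigO_one ℝ (hg.continuousAt.tendsto.comp continuous_snd.continuousAt)
  have h3 := (h1.mul (Asymptotics.IsBigO.norm_right hg)).add
    (h2.mul (Asymptotics.IsBigO.norm_right hf))
  simp only [one_mul] at h3
  exact h3.norm_right.of_norm_right.of_norm_right.congr_left fun q => by ring

lemma comp {f : Y → X} {g : X → ℝ} {y : Y} (hg : LipschitzNear g (f y)) (hf : ContinuousAt f y)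
    (hf' : (fun q : Y × Y => f q.1 - f q.2) =O[nhds (y, y)] fun q => q.1 - q.2) :
    LipschitzNear (fun z => g (f z)) y :=
  (Asymptotics.IsBigO.comp_tendsto hg (hf.prodMap' hf).tendsto).trans hf'

lemma exists_lipschitzOnWith (hf : LipschitzNear f x) :
    ∃ K : NNReal, ∃ s, IsOpen s ∧ x ∈ s ∧ LipschitzOnWith K f s := by
  obtain ⟨K, hK, h⟩ := hf.exists_nonneg
  obtain ⟨s, t, hs, hsx, ht, htx, hsub⟩ := mem_nhds_prod_iff'.1 h.bound
  refine ⟨⟨K, hK⟩, s ∩ t, hs.inter ht, ⟨hsx, htx⟩, LipschitzOnWith.of_dist_le_mul ?_⟩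
  intro y hy z hz
  rw [dist_eq_norm, dist_eq_norm]
  exact hsub (show (y, z) ∈ s ×ˢ t from ⟨hy.1, hz.2⟩)

end LipschitzNear

lemma ContDiffAt.isBigO_sub_prod {X Y : Type*} [NormedAddCommGroup X] [NormedSpace ℝ X]
    [NormedAddCommGroup Y] [NormedSpace ℝ Y] {f : X → Y} {x : X} (hf : ContDiffAt ℝ 1 f x) :
    (fun q : X × X => f q.1 - f q.2) =O[nhds (x, x)] fun q => q.1 - q.2 :=
  (hf.hasStrictFDerivAt one_ne_zero).isBigO_sub

lemma ContDiffAt.lipschitzNear {X : Type*} [NormedAddCommGroup X] [NormedSpace ℝ X]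
    {f : X → ℝ} {x : X} (hf : ContDiffAt ℝ 1 f x) : LipschitzNear f x :=
  hf.isBigO_sub_prod

lemma LipschitzNear.comp_contDiffAt {X Y : Type*} [NormedAddCommGroup X] [NormedSpace ℝ X]
    [NormedAddCommGroup Y] [NormedSpace ℝ Y] {f : Y → X} {g : X → ℝ} {y : Y}
    (hg : LipschitzNear g (f y)) (hf : ContDiffAt ℝ 1 f y) : LipschitzNear (fun z => g (f z)) y :=
  hg.comp hf.continuousAt hf.isBigO_sub_prod

/-- If `∂H/∂t = J(r,t) - γ(r) da/dt` with `H` and `J` Lipschitz and `da/dt` nonzero at `t = 0`,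
then `γ` is Lipschitz: integrate in `t`. -/
lemma LipschitzNear.of_hasDerivAt_snd {H J : ℝ × ℝ → ℝ} {γ a a' : ℝ → ℝ} {r₀ : ℝ}
    (hH : LipschitzNear H (r₀, 0)) (hJ : LipschitzNear J (r₀, 0))
    (ha : ∀ t, HasDerivAt a (a' t) t) (ha0 : a' 0 ≠ 0)
    (hder : ∀ᶠ q in nhds (r₀, (0 : ℝ)),
      HasDerivAt (fun t => H (q.1, t)) (J q - γ q.1 * a' q.2) q.2) :
    LipschitzNear γ r₀ := by
  obtain ⟨K, hK, hHb⟩ := hH.exists_nonneg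
  obtain ⟨L, hL, hJb⟩ := hJ.exists_nonneg
  have hev : ∀ᶠ q : (ℝ × ℝ) × (ℝ × ℝ) in nhds ((r₀, 0), (r₀, 0)),
      (‖H q.1 - H q.2‖ ≤ K * ‖q.1 - q.2‖ ∧ ‖J q.1 - J q.2‖ ≤ L * ‖q.1 - q.2‖) ∧
        HasDerivAt (fun t => H (q.1.1, t)) (J q.1 - γ q.1.1 * a' q.1.2) q.1.2 :=
    (hHb.bound.and hJb.bound).and
      ((continuous_fst.tendsto ((r₀, (0 : ℝ)), (r₀, (0 : ℝ)))).eventually hder)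
  obtain ⟨δ, hδ, hbox⟩ := Metric.eventually_nhds_iff.1 hev
  have hmem : ∀ r t r' t' : ℝ, |r - r₀| < δ → |t| < δ → |r' - r₀| < δ → |t'| < δ →
      dist ((r, t), (r', t')) ((r₀, (0 : ℝ)), (r₀, (0 : ℝ))) < δ := by
    intro r t r' t' h1 h2 h3 h4
    simp [Prod.dist_eq, Real.dist_eq, *]
  obtain ⟨τ, ⟨hτ0, hτδ⟩, hτ⟩ : ∃ τ ∈ Set.Ioo 0 δ, a τ ≠ a 0 := by
    have h1 := ((ha 0).eventually_ne (c := a 0) ha0).filter_mono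
      (nhdsWithin_mono 0 (fun t (ht : t ∈ Set.Ioi (0 : ℝ)) => (ne_of_gt ht)))
    have h2 : ∀ᶠ t in nhdsWithin (0 : ℝ) (Set.Ioi 0), t ∈ Set.Ioo 0 δ := Ioo_mem_nhdsGT hδ
    exact (h2.and h1).exists
  have hA : 0 < |a τ - a 0| := abs_pos.2 (sub_ne_zero.2 hτ)
  refine Asymptotics.IsBigO.of_bound ((2 * K + L * τ) / |a τ - a 0|) ?_
  have hnear : ∀ᶠ r in nhds r₀, |r - r₀| < δ := Metric.ball_mem_nhds r₀ hδ
  rw [nhds_prod_eq]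
  filter_upwards [hnear.prod_mk hnear] with ⟨r, r'⟩ ⟨hr, hr'⟩
  change ‖γ r - γ r'‖ ≤ _ * ‖r - r'‖
  change |r - r₀| < δ at hr
  change |r' - r₀| < δ at hr'
  have hsub : ∀ t : ℝ, ‖(r, t) - (r', t)‖ = |r - r'| := fun t => by
    simp [Prod.norm_def]
  set D : ℝ → ℝ := fun t => H (r, t) - H (r', t) + (γ r - γ r') * a t with hD
  have hlt : ∀ t ∈ Set.Icc 0 τ, |t| < δ := fun t ht => by
    rw [abs_of_nonneg ht.1]; linarith [ht.2]
  have hDd : ∀ t ∈ Set.Icc 0 τ, HasDerivWithinAt D (J (r, t) - J (r', t)) (Set.Icc 0 τ) t := by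
    intro t ht
    have h1 := (hbox (hmem r t r' t hr (hlt t ht) hr' (hlt t ht))).2
    have h2 := (hbox (hmem r' t r t hr' (hlt t ht) hr (hlt t ht))).2
    refine (((h1.sub h2).add ((ha t).const_mul (γ r - γ r'))).congr_deriv ?_).hasDerivWithinAt
    simp only
    ring
  have hmv := (convex_Icc 0 τ).norm_image_sub_le_of_norm_hasDerivWithin_le hDd
    (C := L * |r - r'|) (fun t ht => by
      have := (hbox (hmem r t r' t hr (hlt t ht) hr' (hlt t ht))).1.2
      rwa [hsub] at this) (Set.left_mem_Icc.2 hτ0.le) (Set.right_mem_Icc.2 hτ0.le)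
  have hH0 : |H (r, 0) - H (r', 0)| ≤ K * |r - r'| := by
    have h0 : |(0 : ℝ)| < δ := by simpa using hδ
    have := (hbox (hmem r 0 r' 0 hr h0 hr' h0)).1.1
    rwa [hsub] at this
  have hHτ : |H (r, τ) - H (r', τ)| ≤ K * |r - r'| := by
    have h0 := hlt τ (Set.right_mem_Icc.2 hτ0.le)
    have := (hbox (hmem r τ r' τ hr h0 hr' h0)).1.1
    rwa [hsub] at this
  rw [Real.norm_eq_abs, Real.norm_eq_abs, div_mul_eq_mul_div, le_div_iff₀ hA, ← abs_mul]
  have heq : (γ r - γ r') * (a τ - a 0)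
      = (D τ - D 0) - (H (r, τ) - H (r', τ)) + (H (r, 0) - H (r', 0)) := by
    simp only [hD]; ring
  rw [Real.norm_eq_abs, Real.norm_eq_abs, sub_zero, abs_of_pos hτ0] at hmv
  rw [heq]
  calc _ ≤ |D τ - D 0| + |H (r, τ) - H (r', τ)| + |H (r, 0) - H (r', 0)| :=
        (abs_add_le _ _).trans (by gcongr; exact abs_sub _ _)
    _ ≤ _ := by nlinarith

/-! ### Regularity of the radial profile -/

lemma exists_fderiv_eq_mul_inner_of_radial {E : Type*} [NormedAddCommGroup E]
    [InnerProductSpace ℝ E] {w : E → ℝ} {g : ℝ → ℝ} (hw : Differentiable ℝ w)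
    (hg : ∀ x, w x = g ‖x‖) :
    ∃ G : ℝ → ℝ, ∀ x, x ≠ 0 → ∀ v, fderiv ℝ w x v = G ‖x‖ * inner ℝ x v := by
  rcases subsingleton_or_nontrivial E with hE | hE
  · exact ⟨0, fun x hx => absurd (Subsingleton.elim x 0) hx⟩
  obtain ⟨e, he⟩ := exists_norm_eq E zero_le_one
  refine ⟨fun r => fderiv ℝ w (r • e) e / r, fun x hx v => ?_⟩
  have hx' : 0 < ‖x‖ := norm_pos_iff.2 hx
  have hgd : HasDerivAt g (fderiv ℝ w (‖x‖ • e) e) ‖x‖ := by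
    have h1 : HasDerivAt (fun r : ℝ => r • e) e ‖x‖ := by
      simpa using (hasDerivAt_id ‖x‖).smul_const e
    refine ((hw (‖x‖ • e)).hasFDerivAt.comp_hasDerivAt ‖x‖ h1).congr_of_eventuallyEq ?_
    filter_upwards [lt_mem_nhds hx'] with r hr
    simp [hg, norm_smul, he, abs_of_pos hr]
  have hnorm : HasFDerivAt (fun z : E => ‖z‖) (fderiv ℝ (fun z : E => ‖z‖) x) x :=
    ((contDiffAt_norm ℝ hx (n := 1)).differentiableAt one_ne_zero).hasFDerivAt
  have hD : ‖x‖ * fderiv ℝ (fun z : E => ‖z‖) x v = inner ℝ x v := by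
    have h1 := (hnorm.pow 2).unique (hasStrictFDerivAt_norm_sq x).hasFDerivAt
    have h2 := congrArg (fun L => L v) h1
    simp at h2
    linarith
  have hwx : fderiv ℝ w x v = fderiv ℝ w (‖x‖ • e) e * fderiv ℝ (fun z : E => ‖z‖) x v := by
    have h1 := hgd.comp_hasFDerivAt x hnorm
    rw [show g ∘ (fun z : E => ‖z‖) = w from funext fun z => (hg z).symm] at h1
    rw [h1.fderiv]
    simp
  rw [hwx, ← hD]
  field_simp

section

variable {N : ℕ}

local notation "𝔼" => EuclideanSpace ℝ (Fin N)

lemma lipschitzNear_profile {Pts : Finset 𝔼} {w : 𝔼 → ℝ} {G : ℝ → ℝ} {ε : 𝔼 → ℝ}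
    (hw : ContDiff ℝ 1 w)
    (hG : ∀ x, x ≠ 0 → ∀ v, fderiv ℝ w x v = G ‖x‖ * inner ℝ x v)
    {x₀ y v : 𝔼} {α : Fin N} (hy : y ∈ Pts) (hε : ε y = 1 ∨ ε y = -1)
    (hx₀ : ∀ z ∈ Pts, x₀ ≠ z) (hα : (x₀ - y) α ≠ 0) (hv : ‖v‖ = 1)
    (hxv : inner ℝ (x₀ - y) v = 0) (hzv : ∀ z ∈ Pts, z ≠ y → inner ℝ (y - z) v ≠ 0)
    (hF : LipschitzNear (fun x => ∑ z ∈ Pts, ε z * (G ‖x - z‖ * (x - z) α)) x₀) :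
    LipschitzNear G ‖x₀ - y‖ := by
  set r₀ : ℝ := ‖x₀ - y‖ with hr₀
  have hr₀pos : 0 < r₀ := norm_pos_iff.2 (sub_ne_zero.2 (hx₀ y hy))
  set e : 𝔼 := r₀⁻¹ • (x₀ - y) with he
  have hre : r₀ • e = x₀ - y := by rw [he, smul_inv_smul₀ hr₀pos.ne']
  have hee : inner ℝ e e = 1 := by
    rw [real_inner_self_eq_norm_sq, he, norm_smul, norm_inv, norm_norm, ← hr₀,
      inv_mul_cancel₀ hr₀pos.ne', one_pow]
  have hvv : inner ℝ v v = 1 := by rw [real_inner_self_eq_norm_sq, hv, one_pow]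
  have hev : inner ℝ e v = 0 := by rw [he, real_inner_smul_left, hxv, mul_zero]
  have heα : e α ≠ 0 := by
    rw [he]
    exact mul_ne_zero (inv_ne_zero hr₀pos.ne') hα
  set X : ℝ × ℝ → 𝔼 := fun q => y + (q.1 * Real.cos q.2) • e + (q.1 * Real.sin q.2) • v with hX
  set X' : ℝ × ℝ → 𝔼 := fun q => (q.1 * -Real.sin q.2) • e + (q.1 * Real.cos q.2) • v with hX'
  have hXsmooth : ContDiff ℝ 1 X := by
    simp only [hX]
    fun_prop
  have hXd : ∀ q : ℝ × ℝ, HasDerivAt (fun t => X (q.1, t)) (X' q) q.2 := fun q => by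
    have h1 := ((Real.hasDerivAt_cos q.2).const_mul q.1).smul_const e
    have h2 := ((Real.hasDerivAt_sin q.2).const_mul q.1).smul_const v
    exact (h1.const_add y).add h2
  have hX0 : X (r₀, 0) = x₀ := by simp [hX, hre]
  have hXnorm : ∀ q, ‖X q - y‖ = |q.1| := fun q => by
    have : ‖X q - y‖ ^ 2 = |q.1| ^ 2 := by
      rw [← real_inner_self_eq_norm_sq, hX, show y + (q.1 * Real.cos q.2) • e
        + (q.1 * Real.sin q.2) • v - y =
          (q.1 * Real.cos q.2) • e + (q.1 * Real.sin q.2) • v by abel]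
      simp only [inner_add_left, inner_add_right, real_inner_smul_left, real_inner_smul_right,
        hee, hvv, hev, real_inner_comm e v ▸ hev, sq_abs]
      linear_combination q.1 ^ 2 * Real.sin_sq_add_cos_sq q.2
    exact (pow_left_inj₀ (norm_nonneg _) (abs_nonneg _) two_ne_zero).1 this
  set num : 𝔼 → ℝ × ℝ → ℝ := fun z q =>
    q.1 * (Real.cos q.2 * e α + Real.sin q.2 * v α) + (y - z) α with hnum
  set num' : ℝ × ℝ → ℝ := fun q =>
    q.1 * (-Real.sin q.2 * e α + Real.cos q.2 * v α) with hnum'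
  set den : 𝔼 → ℝ × ℝ → ℝ := fun z q =>
    q.1 * (-Real.sin q.2 * inner ℝ (y - z) e + Real.cos q.2 * inner ℝ (y - z) v) with hden
  set den' : 𝔼 → ℝ × ℝ → ℝ := fun z q =>
    q.1 * (-Real.cos q.2 * inner ℝ (y - z) e + -Real.sin q.2 * inner ℝ (y - z) v) with hden'
  have hXnum : ∀ z q, (X q - z) α = num z q := fun z q => by
    simp [hX, hnum]
    ring
  have hXden : ∀ z q, inner ℝ (X q - z) (X' q) = den z q := fun z q => by
    rw [hX, hX', hden, show y + (q.1 * Real.cos q.2) • e + (q.1 * Real.sin q.2) • v - z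
      = (y - z) + (q.1 * Real.cos q.2) • e + (q.1 * Real.sin q.2) • v by abel]
    simp only [inner_add_left, inner_add_right, real_inner_smul_left, real_inner_smul_right,
        hee, hvv, hev, real_inner_comm e v ▸ hev]
    ring
  have hnumd : ∀ z q, HasDerivAt (fun t => num z (q.1, t)) (num' q) q.2 := fun z q =>
    ((((Real.hasDerivAt_cos q.2).mul_const (e α)).add
      ((Real.hasDerivAt_sin q.2).mul_const (v α))).const_mul q.1).add_const _
  have hdend : ∀ z q, HasDerivAt (fun t => den z (q.1, t)) (den' z q) q.2 := fun z q =>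
    (((Real.hasDerivAt_sin q.2).neg.mul_const _).add
      ((Real.hasDerivAt_cos q.2).mul_const _)).const_mul q.1
  have hnumc : ∀ z, ContDiff ℝ 1 (num z) := fun z => by simp only [hnum]; fun_prop
  have hnumc' : ContDiff ℝ 1 num' := by simp only [hnum']; fun_prop
  have hdenc : ∀ z, ContDiff ℝ 1 (den z) := fun z => by simp only [hden]; fun_prop
  have hdenc' : ∀ z, ContDiff ℝ 1 (den' z) := fun z => by simp only [hden']; fun_prop
  have hden0 : ∀ z ∈ Pts.erase y, den z (r₀, 0) ≠ 0 := fun z hz => by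
    have := hzv z (Finset.mem_of_mem_erase hz) (Finset.ne_of_mem_erase hz)
    simpa [hden] using ⟨hr₀pos.ne', this⟩
  have hwX : ∀ z, LipschitzNear (fun q => ε z * w (X q - z)) (r₀, (0 : ℝ)) := fun z =>
    ContDiff.contDiffAt (by fun_prop) |>.lipschitzNear
  have hH : LipschitzNear (fun q => ∑ z ∈ Pts.erase y, num z q / den z q * (ε z * w (X q - z)))
      (r₀, (0 : ℝ)) := LipschitzNear.sum fun z hz =>
    (((hnumc z).contDiffAt.div (hdenc z).contDiffAt (hden0 z hz)).lipschitzNear).mul (hwX z)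
  have hK : LipschitzNear (fun q => ∑ z ∈ Pts.erase y,
      (num' q * den z q - num z q * den' z q) / den z q ^ 2 * (ε z * w (X q - z)))
      (r₀, (0 : ℝ)) := LipschitzNear.sum fun z hz =>
    ((((hnumc'.mul (hdenc z)).sub ((hnumc z).mul (hdenc' z))).contDiffAt.div
      ((hdenc z).pow 2).contDiffAt (pow_ne_zero 2 (hden0 z hz))).lipschitzNear).mul (hwX z)
  have hFX := LipschitzNear.comp_contDiffAt (y := (r₀, (0 : ℝ))) (f := X) (by rwa [hX0])
    hXsmooth.contDiffAt (g := fun x => ∑ z ∈ Pts, ε z * (G ‖x - z‖ * (x - z) α))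
  have hγ : LipschitzNear (fun r => ε y * (G r * r)) r₀ := by
    refine hH.of_hasDerivAt_snd (hK.add hFX) (a := fun t => Real.sin t * e α - Real.cos t * v α)
      (a' := fun t => Real.cos t * e α - -Real.sin t * v α)
      (fun t => ((Real.hasDerivAt_sin t).mul_const _).sub ((Real.hasDerivAt_cos t).mul_const _))
      (by simpa using heα) ?_
    have h1 : ∀ᶠ q in nhds (r₀, (0 : ℝ)), 0 < q.1 :=
      continuous_fst.continuousAt.eventually (lt_mem_nhds hr₀pos)
    have h2 : ∀ᶠ q in nhds (r₀, (0 : ℝ)), ∀ z ∈ Pts.erase y, den z q ≠ 0 :=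
      (Finset.eventually_all _).2 fun z hz =>
        (hdenc z).continuous.continuousAt.eventually_ne (hden0 z hz)
    have h3 : ∀ᶠ q in nhds (r₀, (0 : ℝ)), ∀ z ∈ Pts.erase y, X q - z ≠ 0 :=
      (Finset.eventually_all _).2 fun z hz =>
        (hXsmooth.continuous.sub continuous_const).continuousAt.eventually_ne
          (by simpa [hX0] using sub_ne_zero.2 (hx₀ z (Finset.mem_of_mem_erase hz)))
    filter_upwards [h1, h2, h3] with q hq1 hq2 hq3
    have hterm : ∀ z ∈ Pts.erase y, HasDerivAt
        (fun t => num z (q.1, t) / den z (q.1, t) * (ε z * w (X (q.1, t) - z)))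
        ((num' q * den z q - num z q * den' z q) / den z q ^ 2 * (ε z * w (X q - z))
          + ε z * (G ‖X q - z‖ * (X q - z) α)) q.2 := by
      intro z hz
      have hwd : HasDerivAt (fun t => w (X (q.1, t) - z)) (fderiv ℝ w (X q - z) (X' q)) q.2 :=
        ((hw.differentiable one_ne_zero) (X q - z)).hasFDerivAt.comp_hasDerivAt q.2
          ((hXd q).sub_const z)
      refine (((hnumd z q).div (hdend z q) (hq2 z hz)).mul (hwd.const_mul (ε z))).congr_deriv ?_
      rw [hG _ (hq3 z hz), hXden, hXnum]
      have := hq2 z hz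
      simp only [Prod.mk.eta, Pi.div_apply]
      field_simp
    refine (HasDerivAt.fun_sum hterm).congr_deriv ?_
    rw [Finset.sum_add_distrib, ← Finset.add_sum_erase _ _ hy, hXnorm, hXnum, abs_of_pos hq1]
    simp [hnum]
    ring
  have hε2 : ε y * ε y = 1 := by rcases hε with h | h <;> rw [h] <;> norm_num
  have hinv : LipschitzNear (fun r : ℝ => ε y * r⁻¹) r₀ :=
    (contDiffAt_const.mul (contDiffAt_inv ℝ hr₀pos.ne')).lipschitzNear
  refine (hγ.mul hinv).congr ?_
  filter_upwards [lt_mem_nhds hr₀pos] with r hr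
  field_simp
  linear_combination G r * hε2

lemma LipschitzNear.radial_gradient {Pts : Finset 𝔼} {G : ℝ → ℝ} {x₀ : 𝔼} (ε : 𝔼 → ℝ)
    (hx₀ : ∀ z ∈ Pts, x₀ ≠ z) (hG : ∀ z ∈ Pts, LipschitzNear G ‖x₀ - z‖) (β : Fin N) :
    LipschitzNear (fun x => ∑ z ∈ Pts, ε z * (G ‖x - z‖ * (x - z) β)) x₀ := by
  refine LipschitzNear.sum fun z hz => ?_
  have h1 : ContDiffAt ℝ 1 (fun x : 𝔼 => ‖x - z‖) x₀ :=
    (contDiffAt_id.sub contDiffAt_const).norm ℝ (sub_ne_zero.2 (hx₀ z hz))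
  have h2 : ContDiffAt ℝ 1 (fun x : 𝔼 => (x - z) β) x₀ := by
    refine ContDiff.contDiffAt ?_
    simp only [PiLp.sub_apply]
    fun_prop
  exact (contDiffAt_const (c := ε z)).lipschitzNear.mul
    (((hG z hz).comp_contDiffAt (f := fun x => ‖x - z‖) h1).mul h2.lipschitzNear)

end

/-! ### Density of the points where the gradient of `U` is differentiable -/

section

variable {N : ℕ}

local notation "𝔼" => EuclideanSpace ℝ (Fin N)

lemma ae_sub_notMem_submodule {E : Type*} [NormedAddCommGroup E] [NormedSpace ℝ E]
    [FiniteDimensional ℝ E] [MeasurableSpace E] [BorelSpace E] (μ : Measure E)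
    [μ.IsAddHaarMeasure] {S : Submodule ℝ E} (hS : S ≠ ⊤) (y : E) : ∀ᵐ x ∂μ, x - y ∉ S := by
  have h := Measure.addHaar_affineSubspace μ (AffineSubspace.mk' y S) fun h => hS <| by
    rw [← AffineSubspace.direction_mk' y S, h, AffineSubspace.direction_top]
  rw [ae_iff]
  refine measure_mono_null (fun x hx => ?_) h
  simpa [AffineSubspace.mem_mk'] using hx

lemma span_singleton_ne_top (hN : 2 ≤ N) (y : 𝔼) : Submodule.span ℝ {y} ≠ ⊤ := fun h => by
  have h1 := finrank_span_le_card (R := ℝ) ({y} : Set 𝔼)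
  rw [h, finrank_top, finrank_euclideanSpace_fin, Set.toFinset_singleton,
    Finset.card_singleton] at h1
  omega

lemma exists_mem_generic (hN : 2 ≤ N) {O : Set 𝔼} (hO : IsOpen O) (hne : O.Nonempty)
    (Pts : Finset 𝔼) (α : Fin N) :
    ∃ x ∈ O, (∀ z ∈ Pts, (x - z) α ≠ 0) ∧
      ∀ y ∈ Pts, ∀ z ∈ Pts, z ≠ y → y - z ∉ Submodule.span ℝ {x - y} := by
  have h1 : ∀ᵐ x : 𝔼, ∀ z ∈ Pts, (x - z) α ≠ 0 := by
    refine (ae_ball_iff Pts.countable_toSet).2 fun z _ => ?_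
    have hS : LinearMap.ker (EuclideanSpace.proj α : 𝔼 →L[ℝ] ℝ).toLinearMap ≠ ⊤ := fun h => by
      have : EuclideanSpace.single α (1 : ℝ) ∈
          LinearMap.ker (EuclideanSpace.proj α : 𝔼 →L[ℝ] ℝ).toLinearMap := h ▸ Submodule.mem_top
      simp at this
    filter_upwards [ae_sub_notMem_submodule volume hS z] with x hx
    simpa using hx
  have h2 : ∀ᵐ x : 𝔼, ∀ y ∈ Pts, ∀ z ∈ Pts, x - y ∉ Submodule.span ℝ {y - z} :=
    (ae_ball_iff Pts.countable_toSet).2 fun y _ => (ae_ball_iff Pts.countable_toSet).2 fun z _ =>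
      ae_sub_notMem_submodule volume (span_singleton_ne_top hN _) y
  obtain ⟨x, hxO, hx1, hx2⟩ :=
    (Measure.dense_of_ae (h1.and h2)).inter_open_nonempty O hO hne
  refine ⟨x, hxO, hx1, fun y hy z hz hzy hmem => ?_⟩
  obtain ⟨c, hc⟩ := Submodule.mem_span_singleton.1 hmem
  have hc0 : c ≠ 0 := by
    rintro rfl
    rw [zero_smul] at hc
    exact hzy (sub_eq_zero.1 hc.symm).symm
  exact hx2 y hy z hz (Submodule.mem_span_singleton.2 ⟨c⁻¹, by rw [← hc, inv_smul_smul₀ hc0]⟩)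

lemma exists_unit_orthogonal_forall_inner_ne_zero (hN : 2 ≤ N) (x : 𝔼) {s : Finset 𝔼}
    (hs : ∀ z ∈ s, z ∉ Submodule.span ℝ {x}) :
    ∃ v : 𝔼, ‖v‖ = 1 ∧ inner ℝ x v = 0 ∧ ∀ z ∈ s, inner ℝ z v ≠ 0 := by
  obtain ⟨u, -, hu⟩ := SetLike.exists_of_lt (lt_top_iff_ne_top.2 (span_singleton_ne_top hN x))
  obtain ⟨f, hf⟩ := Module.exists_dual_forall_apply_ne_zero (K := ℝ)
    (fun z : (insert u s : Finset 𝔼) => (Submodule.span ℝ {x}).mkQ z) fun z hz => by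
      rw [Submodule.mkQ_apply, Submodule.Quotient.mk_eq_zero] at hz
      rcases Finset.mem_insert.1 z.2 with h | h
      · exact hu (h ▸ hz)
      · exact hs _ h hz
  set F : StrongDual ℝ 𝔼 := LinearMap.toContinuousLinearMap (f ∘ₗ (Submodule.span ℝ {x}).mkQ)
  set v : 𝔼 := (InnerProductSpace.toDual ℝ 𝔼).symm F with hv
  have hvF : ∀ z, inner ℝ z v = f ((Submodule.span ℝ {x}).mkQ z) := fun z => by
    rw [real_inner_comm, hv, InnerProductSpace.toDual_symm_apply]
    rfl
  have hne : ∀ z ∈ insert u s, inner ℝ z v ≠ 0 := fun z hz => by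
    rw [hvF]
    exact hf ⟨z, hz⟩
  have hv0 : v ≠ 0 := by
    intro h
    refine hne u (Finset.mem_insert_self _ _) ?_
    rw [h, inner_zero_right]
  have hvn : ‖v‖ ≠ 0 := norm_ne_zero_iff.2 hv0
  refine ⟨‖v‖⁻¹ • v, ?_, ?_, fun z hz => ?_⟩
  · rw [norm_smul, norm_inv, norm_norm, inv_mul_cancel₀ hvn]
  · rw [real_inner_smul_right, hvF, (Submodule.mkQ_apply _ _).trans
      ((Submodule.Quotient.mk_eq_zero _).2 (Submodule.mem_span_singleton_self x)), map_zero,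
      mul_zero]
  · rw [real_inner_smul_right]
    exact mul_ne_zero (inv_ne_zero hvn) (hne z (Finset.mem_insert_of_mem hz))

/-- The points near which `f` satisfies a Lipschitz estimate with constant `n` at scale
`1 / (n + 1)`. -/
def lipschitzPoints {E : Type*} [NormedAddCommGroup E] (f : E → ℝ) (n : ℕ) : Set E :=
  {x | ∀ y, ‖y - x‖ < 1 / (n + 1 : ℝ) → |f y - f x| ≤ n * ‖y - x‖}

lemma isClosed_lipschitzPoints {E : Type*} [NormedAddCommGroup E] {f : E → ℝ} (hf : Continuous f)
    (n : ℕ) : IsClosed (lipschitzPoints f n) := by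
  rw [lipschitzPoints, Set.ofPred_forall]
  refine isClosed_iInter fun y => isClosed_imp (isOpen_lt ?_ ?_) (isClosed_le ?_ ?_) <;> fun_prop

lemma DifferentiableAt.exists_mem_lipschitzPoints {E : Type*} [NormedAddCommGroup E]
    [NormedSpace ℝ E] {f : E → ℝ} {x : E} (hf : DifferentiableAt ℝ f x) :
    ∃ n, x ∈ lipschitzPoints f n := by
  obtain ⟨c, hc⟩ := hf.isBigO_sub.bound
  obtain ⟨δ, hδ, hball⟩ := Metric.eventually_nhds_iff.1 hc
  obtain ⟨n₁, hn₁⟩ := exists_nat_ge c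
  obtain ⟨n₂, hn₂⟩ := exists_nat_one_div_lt hδ
  refine ⟨max n₁ n₂, fun y hy => ?_⟩
  have hyδ : Dist.dist y x < δ := by
    rw [dist_eq_norm]
    refine hy.trans_le (le_trans ?_ hn₂.le)
    gcongr
    exact le_max_right _ _
  refine (hball hyδ).trans ?_
  gcongr
  exact hn₁.trans (by exact_mod_cast le_max_left _ _)

lemma lipschitzNear_of_mem_interior_lipschitzPoints {E : Type*} [NormedAddCommGroup E] {f : E → ℝ}
    {n : ℕ} {x : E} (hx : x ∈ interior (lipschitzPoints f n)) : LipschitzNear f x := by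
  refine Asymptotics.IsBigO.of_bound n ?_
  have h1 : ∀ᶠ q : E × E in nhds (x, x), q.2 ∈ lipschitzPoints f n :=
    continuous_snd.continuousAt.eventually (mem_interior_iff_mem_nhds.1 hx)
  have h2 : ∀ᶠ q : E × E in nhds (x, x), ‖q.1 - q.2‖ < 1 / (n + 1 : ℝ) := by
    have : ContinuousAt (fun q : E × E => ‖q.1 - q.2‖) (x, x) := by fun_prop
    refine this.eventually_lt continuousAt_const ?_
    simp only [sub_self, norm_zero]
    positivity
  filter_upwards [h1, h2] with q hq1 hq2 using hq1 q.1 hq2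

lemma LipschitzNear.frequently_differentiableAt {E ι : Type*} [NormedAddCommGroup E]
    [NormedSpace ℝ E] [FiniteDimensional ℝ E] [Finite ι] {f : ι → E → ℝ} {x : E}
    (hf : ∀ i, LipschitzNear (f i) x) : ∃ᶠ z in nhds x, ∀ i, DifferentiableAt ℝ (f i) z := by
  borelize E
  choose K s hso hxs hs using fun i => (hf i).exists_lipschitzOnWith
  rw [frequently_nhds_iff]
  intro V hxV hV
  have hO : IsOpen (V ∩ ⋂ i, s i) := hV.inter (isOpen_iInter_of_finite hso)
  have hae : ∀ᵐ z ∂(Measure.addHaar : Measure E), ∀ i, z ∈ s i → DifferentiableAt ℝ (f i) z := by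
    rw [ae_all_iff]
    intro i
    filter_upwards [(ae_restrict_iff' (hso i).measurableSet).1
      ((hs i).ae_differentiableWithinAt (hso i).measurableSet)] with z hz hzs
    exact (hz hzs).differentiableAt ((hso i).mem_nhds hzs)
  obtain ⟨z, hz, hzd⟩ :=
    (Measure.dense_of_ae hae).inter_open_nonempty _ hO ⟨x, hxV, Set.mem_iInter.2 hxs⟩
  exact ⟨z, hz.1, fun i => hzd i (Set.mem_iInter.1 hz.2 i)⟩

end

section

variable {N : ℕ}

local notation "𝔼" => EuclideanSpace ℝ (Fin N)

lemma pdc_sum_translates {Pts : Finset 𝔼} {w U : 𝔼 → ℝ} {ε : 𝔼 → ℝ} (hw : Differentiable ℝ w)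
    (hU : ∀ x, U x = ∑ y ∈ Pts, ε y * w (x - y)) (β : Fin N) (x : 𝔼) :
    pdc β U x = ∑ y ∈ Pts, ε y * fderiv ℝ w (x - y) (EuclideanSpace.single β 1) := by
  have h : HasFDerivAt U (∑ y ∈ Pts, ε y • fderiv ℝ w (x - y)) x := by
    rw [funext hU]
    exact HasFDerivAt.fun_sum fun y _ =>
      ((hw (x - y)).hasFDerivAt.comp x ((hasFDerivAt_id x).sub_const y)).const_mul (ε y)
  simp [pdc, h.fderiv]

lemma pdc_sum_translates_radial {Pts : Finset 𝔼} {w U : 𝔼 → ℝ} {G : ℝ → ℝ} {ε : 𝔼 → ℝ}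
    (hw : Differentiable ℝ w) (hG : ∀ x, x ≠ 0 → ∀ v, fderiv ℝ w x v = G ‖x‖ * inner ℝ x v)
    (hU : ∀ x, U x = ∑ y ∈ Pts, ε y * w (x - y)) (β : Fin N) {x : 𝔼} (hx : ∀ y ∈ Pts, x ≠ y) :
    pdc β U x = ∑ y ∈ Pts, ε y * (G ‖x - y‖ * (x - y) β) := by
  rw [pdc_sum_translates hw hU]
  refine Finset.sum_congr rfl fun y hy => ?_
  rw [hG _ (sub_ne_zero.2 (hx y hy)), EuclideanSpace.inner_single_right]
  simp

lemma lipschitzNear_pdc_of_generic (hN : 2 ≤ N) {Pts : Finset 𝔼} {w U : 𝔼 → ℝ} {g : ℝ → ℝ}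
    {ε : 𝔼 → ℝ} (hw : ContDiff ℝ 1 w) (hg : ∀ x, w x = g ‖x‖)
    (hε : ∀ y ∈ Pts, ε y = 1 ∨ ε y = -1)
    (hU : ∀ x, U x = ∑ y ∈ Pts, ε y * w (x - y)) {x : 𝔼} {α : Fin N}
    (hα : ∀ y ∈ Pts, (x - y) α ≠ 0)
    (hspan : ∀ y ∈ Pts, ∀ z ∈ Pts, z ≠ y → y - z ∉ Submodule.span ℝ {x - y})
    (hx : LipschitzNear (pdc α U) x) (β : Fin N) : LipschitzNear (pdc β U) x := by
  classical
  have hw' : Differentiable ℝ w := hw.differentiable one_ne_zero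
  obtain ⟨G, hG⟩ := exists_fderiv_eq_mul_inner_of_radial hw' hg
  have hne : ∀ y ∈ Pts, x ≠ y := fun y hy h => hα y hy (by simp [h])
  have heq : ∀ β, pdc β U =ᶠ[nhds x] fun x => ∑ y ∈ Pts, ε y * (G ‖x - y‖ * (x - y) β) := by
    intro β
    have : ∀ᶠ z in nhds x, ∀ y ∈ Pts, z ≠ y :=
      (Filter.eventually_all_finset Pts).2 fun y hy => isOpen_ne.mem_nhds (hne y hy)
    filter_upwards [this] with z hz using pdc_sum_translates_radial hw' hG hU β hz
  refine (LipschitzNear.radial_gradient ε hne (fun y hy => ?_) β).congr (heq β).symm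
  obtain ⟨v, hv, hxv, hzv⟩ := exists_unit_orthogonal_forall_inner_ne_zero hN (x - y)
    (s := (Pts.erase y).image fun z => y - z) fun z' hz' => by
      obtain ⟨z, hz, rfl⟩ := Finset.mem_image.1 hz'
      exact hspan y hy z (Finset.mem_of_mem_erase hz) (Finset.ne_of_mem_erase hz)
  exact lipschitzNear_profile hw hG hy (hε y hy) hne (hα y hy) hv hxv
    (fun z hz hzy => hzv _ (Finset.mem_image_of_mem _ (Finset.mem_erase.2 ⟨hzy, hz⟩)))
    (hx.congr (heq α))

lemma dense_differentiableAt_pdc (hN : 2 ≤ N) {Pts : Finset 𝔼} {w U φ : 𝔼 → ℝ} {g : ℝ → ℝ}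
    {ε : 𝔼 → ℝ} (hw : ContDiff ℝ 1 w) (hg : ∀ x, w x = g ‖x‖)
    (hε : ∀ y ∈ Pts, ε y = 1 ∨ ε y = -1)
    (hU : ∀ x, U x = ∑ y ∈ Pts, ε y * w (x - y)) (hUc : ContDiff ℝ 1 U) (hφ : ContDiff ℝ 2 φ)
    (V : Finset ℝ)
    (hV : ∀ x, (∀ α, ¬ DifferentiableAt ℝ (pdc α U) x) → U x + φ x ∈ V) :
    Dense {x | ∀ β, DifferentiableAt ℝ (pdc β U) x} := by
  have hpdc : ∀ α, Continuous (pdc α U) := fun α => (hUc.pdc (m := 0) (by norm_num) α).continuous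
  let K : (Fin N × ℕ) ⊕ V → Set 𝔼 :=
    Sum.elim (fun i => lipschitzPoints (pdc i.1 U) i.2) fun c => {x | U x + φ x = c}
  have hKc : ∀ i, IsClosed (K i) := by
    rintro (i | c)
    · exact isClosed_lipschitzPoints (hpdc _) _
    · exact isClosed_eq (hUc.continuous.add hφ.continuous) continuous_const
  have hK : ⋃ i, K i = Set.univ := by
    refine Set.eq_univ_of_forall fun x => Set.mem_iUnion.2 ?_
    by_cases h : ∃ α, DifferentiableAt ℝ (pdc α U) x
    · obtain ⟨α, hα⟩ := h
      obtain ⟨n, hn⟩ := hα.exists_mem_lipschitzPoints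
      exact ⟨Sum.inl (α, n), hn⟩
    · exact ⟨Sum.inr ⟨_, hV x (not_exists.1 h)⟩, rfl⟩
  refine dense_iff_inter_open.2 fun O hO hne => ?_
  obtain ⟨x, hxO, hx⟩ := (dense_iUnion_interior_of_closed hKc hK).inter_open_nonempty O hO hne
  obtain ⟨⟨α, n⟩ | c, hi⟩ := Set.mem_iUnion.1 hx
  · obtain ⟨x₀, ⟨hx₀O, hx₀⟩, hα, hspan⟩ :=
      exists_mem_generic hN (hO.inter isOpen_interior) ⟨x, hxO, hi⟩ Pts α
    have hL := lipschitzNear_pdc_of_generic hN hw hg hε hU hα hspan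
      (lipschitzNear_of_mem_interior_lipschitzPoints hx₀)
    obtain ⟨z, hz, hzO⟩ := ((LipschitzNear.frequently_differentiableAt hL).and_eventually
      (hO.mem_nhds hx₀O)).exists
    exact ⟨z, hzO, hz⟩
  · refine ⟨x, hxO, fun β => ?_⟩
    have h1 : ∀ᶠ y in nhds x, U =ᶠ[nhds y] fun z => c - φ z := by
      filter_upwards [isOpen_interior.mem_nhds hi] with y hy
      filter_upwards [isOpen_interior.mem_nhds hy] with z hz
      exact eq_sub_of_add_eq (show U z + φ z = c from interior_subset (s := K _) hz)
    have h2 : pdc β U =ᶠ[nhds x] fun z => - pdc β φ z := by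
      filter_upwards [h1] with y hy
      simp [pdc, hy.fderiv_eq, fderiv_const_sub]
    have h3 := (hφ.pdc (m := 1) (by norm_num) β).differentiable one_ne_zero
    exact (h3.neg x).congr_of_eventuallyEq h2

end

lemma pdc_add {N : ℕ} {f g : EuclideanSpace ℝ (Fin N) → ℝ} {x : EuclideanSpace ℝ (Fin N)}
    (hf : DifferentiableAt ℝ f x) (hg : DifferentiableAt ℝ g x) (α : Fin N) :
    pdc α (fun z => f z + g z) x = pdc α f x + pdc α g x := by
  simp [pdc, fderiv_fun_add hf hg]

lemma eq_zero_or_eq_one_or_eq_neg_one_of_abs_rpow_mul_eq {p u : ℝ} (hp : 1 < p)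
    (h : |u| ^ (p - 1) * u = u) : u = 0 ∨ u = 1 ∨ u = -1 := by
  by_cases hu : u = 0
  · exact Or.inl hu
  refine Or.inr (eq_or_eq_neg_of_abs_eq ?_)
  have h1 : |u| ^ (p - 1) = 1 := mul_right_cancel₀ hu (h.trans (one_mul u).symm)
  exact (Real.rpow_left_inj (abs_nonneg u) zero_le_one (sub_pos.2 hp).ne').1
    (h1.trans (Real.one_rpow _).symm)

lemma lapl_add_of_differentiableAt {N : ℕ} {f g : EuclideanSpace ℝ (Fin N) → ℝ}
    {x : EuclideanSpace ℝ (Fin N)} (hf : Differentiable ℝ f) (hg : ContDiff ℝ 2 g)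
    (hx : ∀ α, DifferentiableAt ℝ (pdc α f) x) :
    lapl (fun z => f z + g z) x = lapl f x + lapl g x := by
  simp only [lapl, ← Finset.sum_add_distrib]
  refine Finset.sum_congr rfl fun α _ => ?_
  rw [funext fun z => pdc_add (hf z) (hg.differentiable two_ne_zero z) α]
  exact pdc_add (hx α) ((hg.pdc (m := 1) (by norm_num) α).differentiable one_ne_zero x) α

lemma lapl_add_eq_zero_of_not_differentiableAt {N : ℕ} {f g : EuclideanSpace ℝ (Fin N) → ℝ}
    {x : EuclideanSpace ℝ (Fin N)} (hf : Differentiable ℝ f) (hg : ContDiff ℝ 2 g)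
    (hx : ∀ α, ¬ DifferentiableAt ℝ (pdc α f) x) : lapl (fun z => f z + g z) x = 0 := by
  refine Finset.sum_eq_zero fun α _ => ?_
  rw [funext fun z => pdc_add (hf z) (hg.differentiable two_ne_zero z) α, pdc,
    fderiv_zero_of_not_differentiableAt fun h => hx α ?_, zero_apply]
  have hg' := (hg.pdc (m := 1) (by norm_num) α).differentiable one_ne_zero x
  exact (h.sub hg').congr_of_eventuallyEq (Filter.Eventually.of_forall fun z => by simp)

lemma sum_exp_norm_add_sub_le {E : Type*} [NormedAddCommGroup E] {η : ℝ} (hη : |η| ≤ 1)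
    (s : Finset E) (x : E) {z : E} (hz : ‖z‖ ≤ 1) :
    ∑ y ∈ s, Real.exp (η * ‖x + z - y‖) ≤ Real.exp 1 * ∑ y ∈ s, Real.exp (η * ‖x - y‖) := by
  rw [Finset.mul_sum]
  refine Finset.sum_le_sum fun y _ => ?_
  rw [← Real.exp_add, Real.exp_le_exp]
  have h1 : |‖x + z - y‖ - ‖x - y‖| ≤ 1 :=
    ((abs_norm_sub_norm_le _ _).trans_eq (by congr 1; abel)).trans hz
  have h2 : η * (‖x + z - y‖ - ‖x - y‖) ≤ 1 := (le_abs_self _).trans <| by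
    rw [abs_mul]
    exact mul_le_one₀ hη (abs_nonneg _) h1
  linarith

/-- There is a constant `C > 0`, depending only on `N, p, η, ξ, C₀`, such
that: whenever the points of `Π` are `ℓ`-separated (`ℓ ≥ 2`), `U = Σ_{y∈Π} ε(y) w(·−y)`,
`E = ΔU − U + |U|^{p−1}U`, `u = U + φ` solves `Δu − u + |u|^{p−1}u = 0`, and both `φ` and `E`
have `‖·‖_*`-norm at most `e^{−(1+ξ)ℓ/2}`, then `‖∂φ/∂x_α‖_* ≤ C e^{−(1+ξ)ℓ/2}` for each `α`.
(Here `‖h‖_* ≤ c` is expressed pointwise as `|h x| ≤ c Σ_{y∈Π} e^{η|x−y|}`.) -/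
theorem stmt_13 (N : ℕ) (hN : 2 ≤ N) (p : ℝ) (hp : 1 < p)
    (η : ℝ) (hη : -1 < η ∧ η < 0) (ξ : ℝ) (hξ : 0 < ξ ∧ ξ < 1) (C₀ : ℝ) :
    ∃ C > (0 : ℝ), ∀ w : EuclideanSpace ℝ (Fin N) → ℝ,
      (∀ x, 0 < w x) → ContDiff ℝ 1 w → (∃ g : ℝ → ℝ, ∀ x, w x = g ‖x‖) →
      (∀ x, w x + ‖fderiv ℝ w x‖ ≤ C₀ * Real.exp (-‖x‖)) →
      ∀ ℓ : ℝ, 2 ≤ ℓ →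
      ∀ Pts : Finset (EuclideanSpace ℝ (Fin N)), Pts.Nonempty →
      (∀ y ∈ Pts, ∀ z ∈ Pts, y ≠ z → ℓ ≤ ‖y - z‖) →
      ∀ ε : EuclideanSpace ℝ (Fin N) → ℝ, (∀ y ∈ Pts, ε y = 1 ∨ ε y = -1) →
      ∀ U Err φ : EuclideanSpace ℝ (Fin N) → ℝ, ContDiff ℝ 2 φ →
      (∀ x, U x = ∑ y ∈ Pts, ε y * w (x - y)) →
      (∀ x, Err x = lapl U x - U x + |U x| ^ (p - 1) * U x) →
      (∀ x, lapl (fun z => U z + φ z) x - (U x + φ x)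
          + |U x + φ x| ^ (p - 1) * (U x + φ x) = 0) →
      (∀ x, |φ x| ≤ Real.exp (-(1 + ξ) * ℓ / 2) * ∑ y ∈ Pts, Real.exp (η * ‖x - y‖)) →
      (∀ x, |Err x| ≤ Real.exp (-(1 + ξ) * ℓ / 2) * ∑ y ∈ Pts, Real.exp (η * ‖x - y‖)) →
      ∀ α : Fin N, ∀ x, |pdc α φ x| ≤
        C * Real.exp (-(1 + ξ) * ℓ / 2) * ∑ y ∈ Pts, Real.exp (η * ‖x - y‖) := by
  obtain ⟨B, hB0, hB⟩ := exists_sum_exp_le (EuclideanSpace ℝ (Fin N)) hη.2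
  set L : ℝ := 2 * (p * ((|C₀| + 1) * B) ^ (p - 1)) with hL
  have hL0 : 0 ≤ L := by positivity
  refine ⟨Real.exp 1 * (N + (3 + L) / 2), by positivity, ?_⟩
  rintro w hw0 hw ⟨g, hg⟩ hdecay ℓ hℓ Pts hPts hsep ε hε U Err φ hφ hU hErr hPDE hφb hEb α x
  set δ : ℝ := Real.exp (-(1 + ξ) * ℓ / 2) with hδ
  have hδ0 : 0 < δ := Real.exp_pos _
  have hδ1 : δ ≤ 1 := Real.exp_le_one_iff.2 (by nlinarith [hξ.1])
  set S : EuclideanSpace ℝ (Fin N) → ℝ := fun x => ∑ y ∈ Pts, Real.exp (η * ‖x - y‖) with hS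
  have hS0 : ∀ x, 0 < S x := fun x => Finset.sum_pos (fun y _ => Real.exp_pos _) hPts
  have hSB : ∀ x, S x ≤ B := hB Pts fun y hy z hz hyz => hℓ.trans (hsep y hy z hz hyz)
  have hSc : Continuous S := by fun_prop
  have hUc : ContDiff ℝ 1 U := by
    rw [funext hU]
    exact ContDiff.sum fun y _ => contDiff_const.mul (hw.comp (contDiff_id.sub contDiff_const))
  have hUd : Differentiable ℝ U := hUc.differentiable one_ne_zero
  have hUb : ∀ x, |U x| ≤ |C₀| * B := fun x => by
    refine le_trans ?_ (mul_le_mul_of_nonneg_left (hSB x) (abs_nonneg C₀))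
    rw [hU, hS, Finset.mul_sum]
    refine (Finset.abs_sum_le_sum_abs _ _).trans (Finset.sum_le_sum fun y hy => ?_)
    have h1 : |ε y| = 1 := by rcases hε y hy with h | h <;> simp [h]
    rw [abs_mul, h1, one_mul, abs_of_pos (hw0 _)]
    calc w (x - y) ≤ C₀ * Real.exp (-‖x - y‖) :=
          (le_add_of_nonneg_right (norm_nonneg _)).trans (hdecay _)
      _ ≤ |C₀| * Real.exp (η * ‖x - y‖) := by
          gcongr
          · exact le_abs_self _
          · nlinarith [norm_nonneg (x - y), hη.1]
  have hφB : ∀ x, |φ x| ≤ B := fun x =>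
    (hφb x).trans ((mul_le_of_le_one_left (hS0 x).le hδ1).trans (hSB x))
  have hdense : Dense {x | ∀ β, DifferentiableAt ℝ (pdc β U) x} := by
    refine dense_differentiableAt_pdc hN hw hg hε hU hUc hφ {0, 1, -1} fun x hx => ?_
    have h := hPDE x
    rw [lapl_add_eq_zero_of_not_differentiableAt hUd hφ hx] at h
    simpa using eq_zero_or_eq_one_or_eq_neg_one_of_abs_rpow_mul_eq hp
      (show |U x + φ x| ^ (p - 1) * (U x + φ x) = U x + φ x by linarith)
  have hlaplc : Continuous (lapl φ) := continuous_finsetSum _ fun β _ =>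
    ((hφ.pdc (m := 1) (by norm_num) β).pdc (m := 0) (by norm_num) β).continuous
  have hlapl : ∀ x, |lapl φ x| ≤ (2 + L) * (δ * S x) := by
    have hcl : IsClosed {x | |lapl φ x| ≤ (2 + L) * (δ * S x)} :=
      isClosed_le hlaplc.abs (by fun_prop)
    refine fun x => (hcl.closure_subset_iff.2 fun x hx => ?_) (hdense x)
    have h1 := hPDE x
    rw [lapl_add_of_differentiableAt hUd hφ hx] at h1
    have h2 := hErr x
    have h3 : |(|U x + φ x| ^ (p - 1) * (U x + φ x)) - |U x| ^ (p - 1) * U x| ≤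
        L * |U x + φ x - U x| := by
      refine abs_rpow_mul_self_sub_le hp ((abs_add_le _ _).trans ?_) ((hUb x).trans ?_) <;>
        linarith [hUb x, hφB x]
    rw [add_sub_cancel_left] at h3
    have h4 := mul_le_mul_of_nonneg_left (hφb x) hL0
    have h5 := abs_le.1 (h3.trans h4)
    have h6 := abs_le.1 (hφb x)
    have h7 := abs_le.1 (hEb x)
    change |lapl φ x| ≤ _
    rw [abs_le]
    constructor <;> linarith [h5.1, h5.2, h6.1, h6.2, h7.1, h7.2]
  have hSx : ∀ z, ‖z‖ ≤ 1 → S (x + z) ≤ Real.exp 1 * S x := fun z hz =>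
    sum_exp_norm_add_sub_le (abs_le.2 ⟨hη.1.le, by linarith [hη.2]⟩) Pts x hz
  have hmain := abs_pdc_le_of_lapl_lt hφ x α (M := δ * (Real.exp 1 * S x))
    (K := (3 + L) * (δ * (Real.exp 1 * S x)))
    (fun z hz => (hφb _).trans (mul_le_mul_of_nonneg_left (hSx z hz) hδ0.le))
    fun z hz => (hlapl _).trans_lt <| by
      have h1 : δ * S (x + z) ≤ δ * (Real.exp 1 * S x) :=
        mul_le_mul_of_nonneg_left (hSx z hz) hδ0.le
      have h2 : 0 < δ * S (x + z) := mul_pos hδ0 (hS0 _)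
      nlinarith
  refine hmain.trans_eq ?_
  ring
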